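/- (Morris–Selberg constant term identity.) Let n be a positive integer, let a be a positive integer, let b be a nonnegative integer, and let m be a positive integer, and write c := m/2. Then the iterated constant term CT_{x_n} CT_{x_{n-1}} ⋯ CT_{x_1} of ∏_{i=1}^{n} (1 - x_i)^{-a} · ∏_{i=1}^{n} x_i^{-b} · ∏_{1 ≤ i < j ≤ n} (x_j - x_i)^{-m} (a rational number) equals, as a real number, S_n(a, b, c) := (1/n!) ∏_{j=0}^{n-1} Γ(a + b + (n-1+j)c) Γ(c) / ( Γ(a + jc) Γ(c + jc) Γ(b + jc + 1) ). -/

import Mathlib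

/-- The iterated formal Laurent series field `ℚ((x_n))((x_{n-1}))⋯((x_1))`,
bundled with its field structure. -/
noncomputable def IterLSAux : ℕ → (α : Type) × Field α
  | 0 => ⟨ℚ, inferInstance⟩
  | n + 1 =>
    letI p := IterLSAux n
    letI := p.2
    ⟨LaurentSeries p.1, inferInstance⟩

/-- The iterated Laurent series field in `n` variables over `ℚ`:
`IterLS n = ℚ((x_n))((x_{n-1}))⋯((x_1))`, the variable with the smallest index
being the outermost one. -/
noncomputable def IterLS (n : ℕ) : Type := (IterLSAux n).1

noncomputable instance (n : ℕ) : Field (IterLS n) := (IterLSAux n).2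

/-- The iterated constant term `CT_{x_n} CT_{x_{n-1}} ⋯ CT_{x_1}`: the coefficient of
the monomial `x_1^0 x_2^0 ⋯ x_n^0`. -/
noncomputable def IterLS.CT : (n : ℕ) → IterLS n → ℚ
  | 0, q => q
  | n + 1, f => IterLS.CT n ((show LaurentSeries (IterLS n) from f).coeff 0)

/-- The variables `x_1, …, x_n` as elements of `IterLS n`; the index `i : Fin n`
corresponds to `x_{i+1}`, and `var n 0 = x_1` is the outermost Laurent variable. -/
noncomputable def IterLS.var : (n : ℕ) → Fin n → IterLS n
  | n + 1, i =>
    Fin.cases (show LaurentSeries (IterLS n) from HahnSeries.single (1 : ℤ) 1)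
      (fun j => show LaurentSeries (IterLS n) from HahnSeries.C (IterLS.var n j)) i

/-- The Morris–Selberg constant
`S_n(a,b,c) = (1/n!) ∏_{j=0}^{n-1} Γ(a+b+(n-1+j)c) Γ(c) / (Γ(a+jc) Γ(c+jc) Γ(b+jc+1))`. -/
noncomputable def morrisSelberg (n : ℕ) (a b c : ℝ) : ℝ :=
  (1 / (n.factorial : ℝ)) *
    ∏ j ∈ Finset.range n,
      (Real.Gamma (a + b + ((n : ℝ) - 1 + (j : ℝ)) * c) * Real.Gamma c) /
        (Real.Gamma (a + (j : ℝ) * c) * Real.Gamma (c + (j : ℝ) * c) *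
          Real.Gamma (b + (j : ℝ) * c + 1))


/-! ### Derivations on Laurent series -/

/-- Leibniz rule for an additive endomorphism. -/
def IsDer {A : Type} [CommRing A] (D : A →+ A) : Prop := ∀ f g, D (f * g) = f * D g + g * D f

theorem IsDer.one {A : Type} [CommRing A] {D : A →+ A} (h : IsDer D) : D 1 = 0 := by
  have := h 1 1
  simpa using this

section LaurentDerivation

variable {L : Type} [Field L]

/-- The derivation of `L((X))` acting as `d` on coefficients plus `c` times the Euler operator. -/
noncomputable def laurFun (d : L →+ L) (c : ℤ) (f : LaurentSeries L) :
    LaurentSeries L where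
  coeff k := d (f.coeff k) + (c * k : ℤ) * f.coeff k
  isPWO_support' := f.isPWO_support.mono (by
    intro k hk
    simp only [Function.mem_support] at hk
    rw [HahnSeries.mem_support]
    intro h
    exact hk (by simp [h]))

theorem laurFun_coeff (d : L →+ L) (c : ℤ) (f : LaurentSeries L) (k : ℤ) :
    (laurFun d c f).coeff k = d (f.coeff k) + (c * k : ℤ) * f.coeff k := rfl

theorem laurFun_support (d : L →+ L) (c : ℤ) (f : LaurentSeries L) :
    (laurFun d c f).support ⊆ f.support := by
  intro k hk
  rw [HahnSeries.mem_support] at hk ⊢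
  intro h
  exact hk (by simp [laurFun_coeff, h])

noncomputable def laurD (d : L →+ L) (c : ℤ) : LaurentSeries L →+ LaurentSeries L where
  toFun := laurFun d c
  map_zero' := by ext k; simp [laurFun_coeff]
  map_add' := by
    intro f g
    ext k
    simp only [laurFun_coeff, HahnSeries.coeff_add, map_add, mul_add]
    abel

theorem laurD_isDer (d : L →+ L) (hd : IsDer d) (c : ℤ) : IsDer (laurD d c) := by
  intro f g
  change laurFun d c (f * g) = f * laurFun d c g + g * laurFun d c f
  rw [mul_comm g]
  ext k
  rw [HahnSeries.coeff_add, laurFun_coeff,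
    HahnSeries.coeff_mul_right' g.isPWO_support (laurFun_support d c g),
    HahnSeries.coeff_mul_left' f.isPWO_support (laurFun_support d c f),
    HahnSeries.coeff_mul, map_sum, Finset.mul_sum, ← Finset.sum_add_distrib,
    ← Finset.sum_add_distrib]
  apply Finset.sum_congr rfl
  rintro ⟨i, j⟩ hij
  have h : i + j = k := (Finset.mem_antidiagonal.1 hij).2.2
  simp only [laurFun_coeff, hd (f.coeff i) (g.coeff j)]
  rw [← h]
  push_cast
  ring

theorem laurD_coeff (d : L →+ L) (c : ℤ) (f : LaurentSeries L) (k : ℤ) :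
    (laurD d c f).coeff k = d (f.coeff k) + (c * k : ℤ) * f.coeff k := rfl

theorem laurD_C (d : L →+ L) (c : ℤ) (u : L) :
    laurD d c (HahnSeries.C u : LaurentSeries L) = HahnSeries.C (d u) := by
  ext k
  rw [laurD_coeff]
  by_cases h : k = 0
  · subst h; simp
  · simp [HahnSeries.C_apply, HahnSeries.coeff_single_of_ne h]

theorem laurD_X (d : L →+ L) (hd : IsDer d) (c : ℤ) :
    laurD d c (HahnSeries.single (1 : ℤ) 1 : LaurentSeries L) =
      (HahnSeries.single (1 : ℤ) (c : L) : LaurentSeries L) := by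
  ext k
  rw [laurD_coeff]
  by_cases h : k = 1
  · subst h; simp [hd.one]
  · simp [HahnSeries.coeff_single_of_ne h]

/-- Constant coefficient of products of inverse powers of `u - X`, `u ≠ 0`. -/
theorem coeff_zero_prod {ι : Type} (s : Finset ι) (u : ι → L) (hu : ∀ i, u i ≠ 0) (e : ι → ℕ)
    (g : L) :
    ((∏ i ∈ s, (HahnSeries.C (u i) - HahnSeries.single (1 : ℤ) 1 : LaurentSeries L) ^
      (-(e i : ℤ))) * HahnSeries.C g).coeff 0 = (∏ i ∈ s, (u i) ^ (-(e i : ℤ))) * g := by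
  have key : ∀ i, (HahnSeries.C (u i) - HahnSeries.single (1 : ℤ) 1 : LaurentSeries L) ^
      (-(e i : ℤ)) =
      HahnSeries.ofPowerSeries ℤ L (((PowerSeries.C (u i) - PowerSeries.X)⁻¹) ^ (e i)) := by
    intro i
    have h1 : HahnSeries.ofPowerSeries ℤ L (PowerSeries.C (u i) - PowerSeries.X) =
        HahnSeries.C (u i) - HahnSeries.single (1 : ℤ) 1 := by
      rw [map_sub, HahnSeries.ofPowerSeries_C, HahnSeries.ofPowerSeries_X]
    have h2 : (PowerSeries.C (u i) - PowerSeries.X) * (PowerSeries.C (u i) - PowerSeries.X)⁻¹ = 1 :=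
      PowerSeries.mul_inv_cancel _ (by simpa using hu i)
    have h3 := congrArg (HahnSeries.ofPowerSeries ℤ L) h2
    rw [map_mul (HahnSeries.ofPowerSeries ℤ L), h1, map_one (HahnSeries.ofPowerSeries ℤ L)] at h3
    rw [zpow_neg, zpow_natCast, map_pow (HahnSeries.ofPowerSeries ℤ L), ← inv_pow, inv_eq_of_mul_eq_one_right h3]
  have hC : (HahnSeries.C g : LaurentSeries L) = HahnSeries.ofPowerSeries ℤ L (PowerSeries.C g) :=
    (HahnSeries.ofPowerSeries_C g).symm
  rw [Finset.prod_congr rfl (fun i _ => key i), hC,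
    ← map_prod (HahnSeries.ofPowerSeries ℤ L), ← map_mul (HahnSeries.ofPowerSeries ℤ L)]
  have := HahnSeries.ofPowerSeries_apply_coeff (Γ := ℤ) (R := L)
    ((∏ i ∈ s, ((PowerSeries.C (u i) - PowerSeries.X)⁻¹) ^ (e i)) * PowerSeries.C g) 0
  rw [Nat.cast_zero] at this
  rw [this, PowerSeries.coeff_zero_eq_constantCoeff_apply, map_mul, map_prod]
  simp

end LaurentDerivation

/-! ### The iterated field -/

noncomputable def iterEquiv (n : ℕ) : LaurentSeries (IterLS n) ≃+* IterLS (n + 1) :=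
  RingEquiv.refl (LaurentSeries (IterLS n))

theorem CT_iterEquiv (n : ℕ) (f : LaurentSeries (IterLS n)) :
    IterLS.CT (n + 1) (iterEquiv n f) = IterLS.CT n (f.coeff 0) := rfl

theorem var_zero' (n : ℕ) :
    IterLS.var (n + 1) 0 = iterEquiv n (HahnSeries.single (1 : ℤ) 1) := rfl

theorem var_succ' (n : ℕ) (j : Fin n) :
    IterLS.var (n + 1) j.succ = iterEquiv n (HahnSeries.C (IterLS.var n j)) := rfl

theorem CT_add : ∀ (n : ℕ) (f g : IterLS n),
    IterLS.CT n (f + g) = IterLS.CT n f + IterLS.CT n g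
  | 0, _, _ => rfl
  | n + 1, f, g => by
    obtain ⟨f, rfl⟩ := (iterEquiv n).surjective f
    obtain ⟨g, rfl⟩ := (iterEquiv n).surjective g
    rw [← map_add, CT_iterEquiv, CT_iterEquiv, CT_iterEquiv, HahnSeries.coeff_add, CT_add n]

noncomputable def CTHom (n : ℕ) : IterLS n →+ ℚ := AddMonoidHom.mk' (IterLS.CT n) (CT_add n)

theorem CTHom_apply (n : ℕ) (f : IterLS n) : CTHom n f = IterLS.CT n f := rfl

theorem CT_one : ∀ n : ℕ, IterLS.CT n 1 = 1
  | 0 => rfl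
  | n + 1 => by
    rw [← map_one (iterEquiv n), CT_iterEquiv, HahnSeries.coeff_one, if_pos rfl, CT_one n]

/-- Transport of a derivation along a ring isomorphism. -/
noncomputable def transD {A B : Type} [CommRing A] [CommRing B] (e : A ≃+* B)
    (d : A →+ A) : B →+ B :=
  (e : A →+* B).toAddMonoidHom.comp (d.comp (e.symm : B →+* A).toAddMonoidHom)

theorem transD_apply' {A B : Type} [CommRing A] [CommRing B] (e : A ≃+* B)
    (d : A →+ A) (f : B) : transD e d f = e (d (e.symm f)) := rfl

theorem transD_isDer {A B : Type} [CommRing A] [CommRing B] (e : A ≃+* B)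
    (d : A →+ A) (hd : IsDer d) : IsDer (transD e d) := by
  intro f g
  rw [transD_apply', map_mul, hd]
  simp [transD_apply']

theorem transD_apply {A B : Type} [CommRing A] [CommRing B] (e : A ≃+* B)
    (d : A →+ A) (f : A) : transD e d (e f) = e (d f) := by
  rw [transD_apply', e.symm_apply_apply]

/-- Existence of the Euler derivations killed by the constant term. -/
theorem exists_euler : ∀ (n : ℕ) (i : Fin n), ∃ D : IterLS n →+ IterLS n, IsDer D ∧
    (∀ j, D (IterLS.var n j) = if j = i then IterLS.var n j else 0) ∧
    ∀ f, IterLS.CT n (D f) = 0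
  | 0, i => i.elim0
  | n + 1, i => by
    refine Fin.cases ?_ (fun i => ?_) i
    · refine ⟨transD (iterEquiv n) (laurD 0 1),
        transD_isDer _ _ (laurD_isDer _ (fun _ _ => by simp) _), ?_, ?_⟩
      · intro j
        refine Fin.cases ?_ (fun j => ?_) j
        · rw [var_zero', transD_apply, laurD_X _ (fun _ _ => by simp)]; simp
        · rw [var_succ', transD_apply, laurD_C]; simp
      · intro f
        obtain ⟨f, rfl⟩ := (iterEquiv n).surjective f
        rw [transD_apply, CT_iterEquiv, laurD_coeff, ← CTHom_apply]
        simp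
    · obtain ⟨d, hD, hd, hd0⟩ := exists_euler n i
      refine ⟨transD (iterEquiv n) (laurD d 0),
        transD_isDer _ _ (laurD_isDer _ hD _), ?_, ?_⟩
      · intro j
        refine Fin.cases ?_ (fun j => ?_) j
        · rw [var_zero', transD_apply, laurD_X _ hD]; simp [Fin.ext_iff]
        · rw [var_succ', transD_apply, laurD_C, hd]
          by_cases h : j = i <;> simp [h]
      · intro f
        obtain ⟨f, rfl⟩ := (iterEquiv n).surjective f
        rw [transD_apply, CT_iterEquiv, laurD_coeff]
        simp [hd0]

theorem C_ne_X {L : Type} [Field L] (u : L) :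
    (HahnSeries.C u : LaurentSeries L) ≠ HahnSeries.single (1 : ℤ) 1 := by
  intro h
  have := congrArg (fun f : LaurentSeries L => f.coeff 1) h
  simp [HahnSeries.C_apply] at this

theorem var_ne_zero : ∀ (n : ℕ) (i : Fin n), IterLS.var n i ≠ 0
  | 0, i => i.elim0
  | n + 1, i => by
    refine Fin.cases ?_ (fun i => ?_) i
    · rw [var_zero', Ne, EmbeddingLike.map_eq_zero_iff]; simp
    · rw [var_succ', Ne, EmbeddingLike.map_eq_zero_iff, map_eq_zero]; exact var_ne_zero n i

theorem var_ne_one : ∀ (n : ℕ) (i : Fin n), IterLS.var n i ≠ 1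
  | 0, i => i.elim0
  | n + 1, i => by
    refine Fin.cases ?_ (fun i => ?_) i
    · rw [var_zero', Ne, EmbeddingLike.map_eq_one_iff, ← map_one HahnSeries.C]
      exact (C_ne_X 1).symm
    · rw [var_succ', Ne, EmbeddingLike.map_eq_one_iff, ← map_one HahnSeries.C]
      exact fun h => var_ne_one n i (HahnSeries.C_injective h)

theorem var_inj : ∀ (n : ℕ), Function.Injective (IterLS.var n)
  | 0 => fun i => i.elim0
  | n + 1 => by
    intro i j
    refine Fin.cases ?_ (fun i => ?_) i <;> refine Fin.cases ?_ (fun j => ?_) j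
    · exact fun _ => rfl
    · rw [var_zero', var_succ']
      exact fun h => absurd ((iterEquiv n).injective h).symm (C_ne_X _)
    · rw [var_zero', var_succ']
      exact fun h => absurd ((iterEquiv n).injective h) (C_ne_X _)
    · rw [var_succ', var_succ']
      exact fun h => congrArg Fin.succ
        (var_inj n (HahnSeries.C_injective ((iterEquiv n).injective h)))

/-! ### Logarithmic derivatives -/

section Log

variable {F : Type} [Field F] {D : F →+ F}

theorem IsDer.log_inv (h : IsDer D) {u l : F} (hu : u ≠ 0) (hl : D u = u * l) :
    D u⁻¹ = u⁻¹ * (-l) := by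
  have h1 := h u u⁻¹
  rw [mul_inv_cancel₀ hu, h.one, hl, inv_mul_cancel_left₀ hu] at h1
  have h2 : u * D u⁻¹ = -l := by linear_combination -h1
  rw [← h2, inv_mul_cancel_left₀ hu]

theorem IsDer.log_mul (h : IsDer D) {u v l k : F} (hl : D u = u * l) (hk : D v = v * k) :
    D (u * v) = (u * v) * (l + k) := by
  rw [h, hl, hk]; ring

theorem IsDer.log_pow (h : IsDer D) {u l : F} (hl : D u = u * l) (e : ℕ) :
    D (u ^ e) = u ^ e * (e * l) := by
  induction e with
  | zero => simp [h.one]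
  | succ e ih => rw [pow_succ, h.log_mul ih hl]; push_cast; ring

theorem IsDer.log_zpow (h : IsDer D) {u l : F} (hu : u ≠ 0) (hl : D u = u * l) (e : ℕ) :
    D (u ^ (-(e : ℤ))) = u ^ (-(e : ℤ)) * (-(e * l)) := by
  rw [zpow_neg, zpow_natCast, h.log_inv (pow_ne_zero e hu) (h.log_pow hl e)]

theorem IsDer.log_prod (h : IsDer D) {ι : Type} (s : Finset ι) (u l : ι → F)
    (hl : ∀ i ∈ s, D (u i) = u i * l i) : D (∏ i ∈ s, u i) = (∏ i ∈ s, u i) * ∑ i ∈ s, l i := by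
  classical
  induction s using Finset.induction_on with
  | empty => simp [h.one]
  | insert i s hi ih =>
    rw [Finset.prod_insert hi, Finset.sum_insert hi]
    exact h.log_mul (hl i (Finset.mem_insert_self i s))
      (ih fun j hj => hl j (Finset.mem_insert_of_mem hj))

end Log

/-! ### Aomoto's argument -/

section Aomoto

variable {F : Type} [Field F] {n : ℕ}

/-- The weight of the Morris identity. -/
noncomputable def wt (x : Fin n → F) (a b m : ℕ) : F :=
  (∏ i : Fin n, (1 - x i) ^ (-(a : ℤ))) * (∏ i : Fin n, (x i) ^ (-(b : ℤ))) *
    ∏ i : Fin n, ∏ j ∈ Finset.Ioi i, (x j - x i) ^ (-(m : ℤ))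

theorem pair_sum (x : Fin n → F) (p : Fin n) :
    ∑ i : Fin n, ∑ j ∈ Finset.Ioi i,
      ((if j = p then x j else 0) - (if i = p then x i else 0)) / (x j - x i) =
    ∑ j : Fin n, x p / (x p - x j) := by
  have h1 : ∀ i j : Fin n,
      ((if j = p then x j else 0) - (if i = p then x i else 0)) / (x j - x i) =
      (if j = p then x p / (x p - x i) else 0) + (if i = p then x p / (x p - x j) else 0) := by
    intro i j
    by_cases hj : j = p <;> by_cases hi : i = p
    · subst hj; subst hi; simp
    · subst hj; simp [hi]
    · subst hi
      simp only [hj, if_false, if_true, zero_sub, zero_add]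
      rw [← neg_sub (x i) (x j), neg_div_neg_eq]
    · simp [hi, hj]
  simp only [h1, Finset.sum_add_distrib, Finset.sum_ite_eq', Finset.mem_Ioi]
  have h2 : ∑ i : Fin n, ∑ j ∈ Finset.Ioi i, (if i = p then x p / (x p - x j) else 0) =
      ∑ j : Fin n, if p < j then x p / (x p - x j) else 0 := by
    rw [Finset.sum_eq_single p]
    · simp only [if_true]
      rw [← Finset.sum_filter]
      congr 1
      ext j; simp
    · intro i _ hi; simp [hi]
    · simp
  rw [h2, ← Finset.sum_add_distrib]
  apply Finset.sum_congr rfl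
  intro j _
  rcases lt_trichotomy j p with h | h | h
  · simp [h, h.not_gt]
  · subst h; simp
  · simp [h, h.not_gt]

theorem log_wt {D : F →+ F} (hD : IsDer D) (x : Fin n → F) (hx : Function.Injective x)
    (hx0 : ∀ i, x i ≠ 0) (hx1 : ∀ i, x i ≠ 1) (p : Fin n)
    (hDx : ∀ j, D (x j) = if j = p then x j else 0) (a b m : ℕ) :
    D (wt x a b m) = wt x a b m *
      (a * (x p / (1 - x p)) - b - m * ∑ j : Fin n, x p / (x p - x j)) := by
  have e1 : D (∏ i : Fin n, (1 - x i) ^ (-(a : ℤ))) = (∏ i : Fin n, (1 - x i) ^ (-(a : ℤ))) *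
      (a * (x p / (1 - x p))) := by
    rw [hD.log_prod _ _ (fun i => if i = p then a * (x p / (1 - x p)) else 0)]
    · simp
    · intro i _
      have h1 : 1 - x i ≠ 0 := sub_ne_zero.2 (hx1 i).symm
      rw [hD.log_zpow (l := if i = p then - (x p / (1 - x p)) else 0) h1]
      · split_ifs <;> simp
      · rw [map_sub, hD.one, hDx]
        split_ifs with h
        · subst h; field_simp; ring
        · simp
  have e2 : D (∏ i : Fin n, (x i) ^ (-(b : ℤ))) = (∏ i : Fin n, (x i) ^ (-(b : ℤ))) *
      (-b) := by
    rw [hD.log_prod _ _ (fun i => if i = p then -(b : F) else 0)]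
    · simp
    · intro i _
      rw [hD.log_zpow (l := if i = p then 1 else 0) (hx0 i)]
      · split_ifs <;> simp
      · rw [hDx]
        split_ifs <;> simp
  have e3 : D (∏ i : Fin n, ∏ j ∈ Finset.Ioi i, (x j - x i) ^ (-(m : ℤ))) =
      (∏ i : Fin n, ∏ j ∈ Finset.Ioi i, (x j - x i) ^ (-(m : ℤ))) *
      (-(m * ∑ j : Fin n, x p / (x p - x j))) := by
    rw [hD.log_prod _ _ (fun i => ∑ j ∈ Finset.Ioi i, -(m *
      (((if j = p then x j else 0) - (if i = p then x i else 0)) / (x j - x i))))]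
    · rw [← pair_sum x p]
      simp only [Finset.mul_sum, Finset.sum_neg_distrib]
    · intro i _
      apply hD.log_prod
      intro j hj
      have h1 : x j - x i ≠ 0 :=
        sub_ne_zero.2 (fun h => (Finset.mem_Ioi.1 hj).ne' (hx h))
      apply hD.log_zpow h1
      rw [map_sub, hDx, hDx, mul_div_cancel₀ _ h1]
  rw [wt, hD.log_mul (hD.log_mul e1 e2) e3]
  ring

/-- The symmetrised functional. -/
noncomputable def br (ct : F →+ ℚ) (x : Fin n → F) (W : F) (g : (Fin n → F) → F) : ℚ :=
  ∑ σ : Equiv.Perm (Fin n), ct (g (x ∘ σ) * W)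

theorem br_congr (ct : F →+ ℚ) (x : Fin n → F) (W : F) (g h : (Fin n → F) → F)
    (e : ∀ σ : Equiv.Perm (Fin n), g (x ∘ σ) = h (x ∘ σ)) : br ct x W g = br ct x W h := by
  simp only [br, e]

theorem br_add (ct : F →+ ℚ) (x : Fin n → F) (W : F) (g h : (Fin n → F) → F) :
    br ct x W (fun y => g y + h y) = br ct x W g + br ct x W h := by
  simp only [br, add_mul, map_add, Finset.sum_add_distrib]

theorem br_sub (ct : F →+ ℚ) (x : Fin n → F) (W : F) (g h : (Fin n → F) → F) :
    br ct x W (fun y => g y - h y) = br ct x W g - br ct x W h := by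
  simp only [br, sub_mul, map_sub, Finset.sum_sub_distrib]

theorem br_nat (ct : F →+ ℚ) (x : Fin n → F) (W : F) (k : ℕ) (g : (Fin n → F) → F) :
    br ct x W (fun y => k * g y) = k * br ct x W g := by
  simp only [br, ← nsmul_eq_mul, smul_mul_assoc, map_nsmul, Finset.smul_sum]

theorem br_sum (ct : F →+ ℚ) (x : Fin n → F) (W : F) {ι : Type} (s : Finset ι)
    (g : ι → (Fin n → F) → F) :
    br ct x W (fun y => ∑ i ∈ s, g i y) = ∑ i ∈ s, br ct x W (g i) := by
  simp only [br, Finset.sum_mul, map_sum]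
  rw [Finset.sum_comm]

theorem br_perm (ct : F →+ ℚ) (x : Fin n → F) (W : F) (τ : Equiv.Perm (Fin n))
    (g : (Fin n → F) → F) :
    br ct x W (fun y => g (y ∘ τ)) = br ct x W g := by
  unfold br
  exact Equiv.sum_comp (Equiv.mulRight τ) (fun σ => ct (g (x ∘ σ) * W))

/-- The squarefree monomial. -/
noncomputable def mon (S : Finset (Fin n)) (y : Fin n → F) : F := ∏ s ∈ S, y s

theorem mon_insert (S : Finset (Fin n)) {i : Fin n} (hi : i ∉ S) (y : Fin n → F) :
    mon (insert i S) y = y i * mon S y := Finset.prod_insert hi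

theorem mon_swap_out (S : Finset (Fin n)) {i j : Fin n} (hi : i ∉ S) (hj : j ∉ S)
    (y : Fin n → F) : mon S (y ∘ Equiv.swap i j) = mon S y := by
  apply Finset.prod_congr rfl
  intro s hs
  rw [Function.comp_apply, Equiv.swap_apply_of_ne_of_ne]
  · rintro rfl; exact hi hs
  · rintro rfl; exact hj hs

theorem mon_swap_in (S : Finset (Fin n)) {i j : Fin n} (hi : i ∈ S) (hj : j ∈ S)
    (y : Fin n → F) : mon S (y ∘ Equiv.swap i j) = mon S y := by
  apply Finset.prod_bij (fun s _ => Equiv.swap i j s)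
  · intro s hs
    rw [Equiv.swap_apply_def]
    split_ifs <;> assumption
  · intro s _ t _ h
    exact (Equiv.swap i j).injective h
  · intro t ht
    refine ⟨Equiv.swap i j t, ?_, by simp⟩
    rw [Equiv.swap_apply_def]
    split_ifs <;> assumption
  · intro s _
    rfl

variable (ct : F →+ ℚ) (x : Fin n → F) (W : F)

theorem br_pair_in (hx : Function.Injective x) (S : Finset (Fin n)) {i j : Fin n}
    (hi : i ∉ S) (hj : j ∈ S) :
    2 * br ct x W (fun y => (1 - y i) * mon S y * (y i / (y i - y j))) =
      - br ct x W (mon (insert i S)) := by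
  have hij : i ≠ j := fun h => hi (h ▸ hj)
  have h1 := br_perm ct x W (Equiv.swap i j)
    (fun y => (1 - y i) * mon S y * (y i / (y i - y j)))
  have h2 : br ct x W (fun y => (1 - y i) * mon S y * (y i / (y i - y j))) +
      br ct x W (mon (insert i S)) +
      br ct x W (fun y => (fun y => (1 - y i) * mon S y * (y i / (y i - y j)))
        (y ∘ Equiv.swap i j)) = br ct x W (fun y => 0) := by
    rw [← br_add, ← br_add]
    apply br_congr
    intro σ
    generalize hy : x ∘ σ = y
    have hyi : y i - y j ≠ 0 := by
      rw [← hy]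
      exact sub_ne_zero.2 fun h => hij (σ.injective (hx h))
    have hyj : y j - y i ≠ 0 := by rw [← neg_sub]; exact neg_ne_zero.2 hyi
    have e := mon_swap_in (insert i S) (Finset.mem_insert_self i S)
      (Finset.mem_insert_of_mem hj : j ∈ insert i S) y
    rw [mon_insert S hi, mon_insert S hi] at e
    simp only [Function.comp_apply, Equiv.swap_apply_left, Equiv.swap_apply_right] at e ⊢
    rw [mon_insert S hi]
    have e' : (1 - y j) * mon S (y ∘ Equiv.swap i j) * (y j / (y j - y i)) =
        (1 - y j) * (y i * mon S y) / (y j - y i) := by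
      rw [← e]; ring
    rw [e', ← neg_sub (y i) (y j)]
    field_simp
    ring
  rw [h1] at h2
  have h0 : br ct x W (fun _ => 0) = 0 := by simp [br]
  rw [h0] at h2
  linarith

theorem br_pair_out (hx : Function.Injective x) (S : Finset (Fin n)) {i j : Fin n}
    (hi : i ∉ S) (hj : j ∉ S) (hij : i ≠ j) :
    2 * br ct x W (fun y => (1 - y i) * mon S y * (y i / (y i - y j))) =
      br ct x W (mon S) - 2 * br ct x W (mon (insert i S)) := by
  have h1 := br_perm ct x W (Equiv.swap i j)
    (fun y => (1 - y i) * mon S y * (y i / (y i - y j)))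
  have h3 := br_perm ct x W (Equiv.swap i j) (fun y => mon (insert i S) y)
  have h2 : br ct x W (fun y => (1 - y i) * mon S y * (y i / (y i - y j))) +
      br ct x W (fun y => (fun y => (1 - y i) * mon S y * (y i / (y i - y j)))
        (y ∘ Equiv.swap i j)) + br ct x W (mon (insert i S)) +
      br ct x W (fun y => mon (insert i S) (y ∘ Equiv.swap i j)) = br ct x W (mon S) := by
    rw [← br_add, ← br_add, ← br_add]
    apply br_congr
    intro σ
    generalize hy : x ∘ σ = y
    have hyi : y i - y j ≠ 0 := by
      rw [← hy]
      exact sub_ne_zero.2 fun h => hij (σ.injective (hx h))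
    have hyj : y j - y i ≠ 0 := by rw [← neg_sub]; exact neg_ne_zero.2 hyi
    rw [mon_insert S hi, mon_insert S hi]
    simp only [mon_swap_out S hi hj, Function.comp_apply, Equiv.swap_apply_left,
      Equiv.swap_apply_right]
    rw [← neg_sub (y i) (y j)]
    field_simp
    ring
  rw [h1, h3] at h2
  linarith

theorem aomoto_step (hx : Function.Injective x)
    (hx0 : ∀ i, x i ≠ 0) (hx1 : ∀ i, x i ≠ 1)
    (hD : ∀ p : Fin n, ∃ D : F →+ F, IsDer D ∧ (∀ j, D (x j) = if j = p then x j else 0) ∧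
      ∀ f, ct (D f) = 0)
    (a b m : ℕ) (S : Finset (Fin n)) (i : Fin n) (hi : i ∉ S) :
    (2 * ((a : ℚ) + b - 1) + m * (2 * n - 2 - S.card)) * br ct x (wt x a b m) (mon (insert i S)) =
      (2 * b + m * (n - 1 - S.card)) * br ct x (wt x a b m) (mon S) := by
  set W := wt x a b m with hW
  have key : br ct x W (fun y => (a : F) * mon (insert i S) y + b * mon (insert i S) y
      - mon (insert i S) y - b * mon S y
      - m * ∑ j : Fin n, (1 - y i) * mon S y * (y i / (y i - y j))) = 0 := by
    apply Finset.sum_eq_zero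
    intro σ _
    obtain ⟨D, hD, hDx, hct⟩ := hD (σ i)
    rw [← hct ((1 - x (σ i)) * mon S (x ∘ σ) * W)]
    congr 1
    have hmon : D (mon S (x ∘ σ)) = 0 := by
      have := hD.log_prod S (x ∘ σ) (fun _ => 0) (by
        intro s hs
        have : s ≠ i := by rintro rfl; exact hi hs
        rw [Function.comp_apply, hDx, if_neg (fun h => this (σ.injective h)), mul_zero])
      rw [mon, this]; simp
    have h1 : 1 - x (σ i) ≠ 0 := sub_ne_zero.2 (hx1 _).symm
    beta_reduce
    rw [hD, hD, hmon, map_sub, hD.one, hDx, if_pos rfl, hW,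
      log_wt hD x hx hx0 hx1 (σ i) hDx, ← hW, ← Finset.mul_sum, mon_insert S hi]
    have hs : ∑ j : Fin n, (x ∘ σ) i / ((x ∘ σ) i - (x ∘ σ) j) =
      ∑ j : Fin n, x (σ i) / (x (σ i) - x j) :=
      Equiv.sum_comp σ (fun j => x (σ i) / (x (σ i) - x j))
    rw [hs]
    generalize ∑ j : Fin n, x (σ i) / (x (σ i) - x j) = T
    simp only [Function.comp_apply]
    field_simp
    ring
  rw [br_sub, br_sub, br_sub, br_add, br_nat, br_nat, br_nat, br_nat, br_sum] at key
  have hsum : 2 * ∑ j : Fin n, br ct x W (fun y => (1 - y i) * mon S y * (y i / (y i - y j))) =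
      (S.card : ℚ) * (- br ct x W (mon (insert i S))) +
      ((n : ℚ) - 1 - S.card) *
        (br ct x W (mon S) - 2 * br ct x W (mon (insert i S))) := by
    rw [Finset.mul_sum, ← Finset.sum_add_sum_compl (insert i S), Finset.sum_insert hi]
    have hz : 2 * br ct x W (fun y => (1 - y i) * mon S y * (y i / (y i - y i))) = 0 := by
      simp [br]
    rw [hz, zero_add, Finset.sum_congr rfl (fun j hj => br_pair_in ct x W hx S hi hj),
      Finset.sum_congr (s₁ := (insert i S)ᶜ) rfl (g := fun _ => br ct x W (mon S) - 2 * br ct x W (mon (insert i S)))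
        (fun j hj => by
          rw [Finset.mem_compl, Finset.mem_insert, not_or] at hj
          exact br_pair_out ct x W hx S hi hj.2 (Ne.symm hj.1)),
      Finset.sum_const, Finset.sum_const, nsmul_eq_mul, nsmul_eq_mul, Finset.card_compl,
      Nat.cast_sub (Finset.card_le_univ _), Finset.card_insert_of_notMem hi, Fintype.card_fin]
    push_cast
    ring
  linear_combination 2 * key + (m : ℚ) * hsum

theorem aomoto_chain (hx : Function.Injective x)
    (hx0 : ∀ i, x i ≠ 0) (hx1 : ∀ i, x i ≠ 1)
    (hD : ∀ p : Fin n, ∃ D : F →+ F, IsDer D ∧ (∀ j, D (x j) = if j = p then x j else 0) ∧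
      ∀ f, ct (D f) = 0)
    (a b m : ℕ) (S : Finset (Fin n)) :
    (∏ s ∈ Finset.range S.card, (2 * ((a : ℚ) + b - 1) + m * (2 * n - 2 - s))) *
      br ct x (wt x a b m) (mon S) =
    (∏ s ∈ Finset.range S.card, (2 * (b : ℚ) + m * (n - 1 - s))) *
      br ct x (wt x a b m) (mon ∅) := by
  induction S using Finset.induction_on with
  | empty => simp
  | insert i S hi ih =>
    rw [Finset.card_insert_of_notMem hi, Finset.prod_range_succ, Finset.prod_range_succ, mul_assoc,
      aomoto_step ct x hx hx0 hx1 hD a b m S i hi]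
    linear_combination (2 * (b : ℚ) + m * (n - 1 - S.card)) * ih

theorem aomoto_rec (hx : Function.Injective x)
    (hx0 : ∀ i, x i ≠ 0) (hx1 : ∀ i, x i ≠ 1)
    (hD : ∀ p : Fin n, ∃ D : F →+ F, IsDer D ∧ (∀ j, D (x j) = if j = p then x j else 0) ∧
      ∀ f, ct (D f) = 0)
    (a b m : ℕ) :
    (∏ s ∈ Finset.range n, (2 * ((a : ℚ) + b) + m * (2 * n - 2 - s))) * ct (wt x a b m) =
    (∏ s ∈ Finset.range n, (2 * ((b : ℚ) + 1) + m * (n - 1 - s))) * ct (wt x a (b + 1) m) := by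
  have h := aomoto_chain ct x hx hx0 hx1 hD a (b + 1) m Finset.univ
  have h1 : br ct x (wt x a (b + 1) m) (mon ∅) = (n.factorial : ℚ) * ct (wt x a (b + 1) m) := by
    simp [br, mon, Fintype.card_perm]
  have h2 : br ct x (wt x a (b + 1) m) (mon Finset.univ) = (n.factorial : ℚ) * ct (wt x a b m) := by
    have : ∀ σ : Equiv.Perm (Fin n), mon Finset.univ (x ∘ σ) * wt x a (b + 1) m = wt x a b m := by
      intro σ
      have e : mon Finset.univ (x ∘ σ) = ∏ i, x i := Equiv.prod_comp σ x
      have e2 : (∏ i, x i) * ∏ i : Fin n, (x i) ^ (-((b + 1 : ℕ) : ℤ)) =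
          ∏ i : Fin n, (x i) ^ (-(b : ℤ)) := by
        rw [← Finset.prod_mul_distrib]
        apply Finset.prod_congr rfl
        intro i _
        rw [← zpow_one_add₀ (hx0 i)]
        congr 1
        push_cast
        ring
      rw [e, wt, wt, ← e2]
      ring
    simp [br, this, Fintype.card_perm]
  rw [h1, h2, Finset.card_univ, Fintype.card_fin] at h
  have hf : (n.factorial : ℚ) ≠ 0 := by exact_mod_cast n.factorial_ne_zero
  apply mul_left_cancel₀ hf
  push_cast at h
  simp only [← add_assoc, add_sub_cancel_right] at h
  linear_combination h

end Aomoto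

/-! ### Reduction of the case `b = 0` and the Gamma side -/

theorem CT_base (n a m : ℕ) :
    IterLS.CT (n + 1) (wt (IterLS.var (n + 1)) a 0 m) = IterLS.CT n (wt (IterLS.var n) a m m) := by
  have h : wt (IterLS.var (n + 1)) a 0 m = iterEquiv n
      ((∏ i : Option (Fin n), (HahnSeries.C (i.elim 1 (IterLS.var n)) -
        HahnSeries.single (1 : ℤ) 1 : LaurentSeries (IterLS n)) ^
          (-((i.elim a (fun _ => m) : ℕ) : ℤ))) *
        HahnSeries.C (wt (IterLS.var n) a 0 m)) := by
    rw [Fintype.prod_option]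
    unfold wt
    simp only [Fin.prod_univ_succ, var_zero', var_succ', Fin.Ioi_zero_eq_map, Fin.Ioi_succ,
      Finset.prod_map, Fin.coe_succEmb, Option.elim, map_mul, map_prod, map_zpow₀, map_sub, map_one,
      Nat.cast_zero, neg_zero, zpow_zero, Finset.prod_const_one]
    ring
  rw [h, CT_iterEquiv, coeff_zero_prod]
  · congr 1
    rw [Fintype.prod_option]
    unfold wt
    simp only [Option.elim, one_zpow, Nat.cast_zero, neg_zero, zpow_zero, Finset.prod_const_one]
    ring
  · rintro (_ | i)
    · exact one_ne_zero
    · exact var_ne_zero n i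

theorem morris_base (n : ℕ) (a c : ℝ) (ha : 0 < a) (hc : 0 < c) :
    morrisSelberg (n + 1) a 0 c = morrisSelberg n a (2 * c) c := by
  have G : ∀ z : ℝ, 0 < z → Real.Gamma z ≠ 0 := fun z hz => (Real.Gamma_pos_of_pos hz).ne'
  have hP : ∀ (w : ℝ), 0 < w → ∀ k : ℕ, ∏ j ∈ Finset.range k, Real.Gamma (w + j * c) ≠ 0 :=
    fun w hw k => Finset.prod_ne_zero_iff.2 fun j _ => G _ (by positivity)
  have key : ∀ (k : ℕ) (b : ℝ), morrisSelberg k a b c = (1 / (k.factorial : ℝ)) *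
      ((∏ j ∈ Finset.range k, Real.Gamma (a + b + ((k : ℝ) - 1 + (j : ℝ)) * c)) *
        Real.Gamma c ^ k /
      ((∏ j ∈ Finset.range k, Real.Gamma (a + j * c)) *
        (∏ j ∈ Finset.range k, Real.Gamma (c + j * c)) *
        (∏ j ∈ Finset.range k, Real.Gamma (b + 1 + j * c)))) := by
    intro k b
    rw [morrisSelberg, Finset.prod_div_distrib, Finset.prod_mul_distrib, Finset.prod_mul_distrib,
      Finset.prod_mul_distrib, Finset.prod_const, Finset.card_range]
    simp only [add_right_comm b _ (1 : ℝ)]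
  rw [key, key]
  -- numerator
  have hnum : ∏ j ∈ Finset.range (n + 1),
        Real.Gamma (a + 0 + (((n + 1 : ℕ) : ℝ) - 1 + (j : ℝ)) * c) =
      (∏ j ∈ Finset.range n, Real.Gamma (a + 2 * c + ((n : ℝ) - 1 + (j : ℝ)) * c)) *
        Real.Gamma (a + n * c) := by
    rw [Finset.prod_range_succ']
    congr 1
    · apply Finset.prod_congr rfl
      intro j _
      congr 1
      push_cast
      ring
    · congr 1
      push_cast
      ring
  have hA : ∏ j ∈ Finset.range (n + 1), Real.Gamma (a + j * c) =
      (∏ j ∈ Finset.range n, Real.Gamma (a + j * c)) * Real.Gamma (a + n * c) :=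
    Finset.prod_range_succ _ _
  have hC : ∏ j ∈ Finset.range (n + 1), Real.Gamma (c + j * c) =
      (∏ j ∈ Finset.range n, Real.Gamma (c + j * c)) * Real.Gamma (c + n * c) :=
    Finset.prod_range_succ _ _
  have hB : (∏ j ∈ Finset.range (n + 1), Real.Gamma (0 + 1 + j * c)) *
      (Real.Gamma (c + n * c) * (c + n * c)) =
      (∏ j ∈ Finset.range n, Real.Gamma (2 * c + 1 + j * c)) * (c * Real.Gamma c) := by
    have e1 : Real.Gamma (c + n * c) * (c + n * c) = Real.Gamma (0 + 1 + ((n + 1 : ℕ) : ℝ) * c) := by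
      rw [mul_comm, ← Real.Gamma_add_one (by positivity)]
      congr 1
      push_cast
      ring
    rw [e1, ← Finset.prod_range_succ (fun j : ℕ => Real.Gamma (0 + 1 + (j : ℝ) * c)),
      Finset.prod_range_succ', Finset.prod_range_succ']
    have e2 : Real.Gamma (0 + 1 + ((0 : ℕ) : ℝ) * c) = 1 := by simp
    have e3 : Real.Gamma (0 + 1 + ((0 + 1 : ℕ) : ℝ) * c) = c * Real.Gamma c := by
      rw [← Real.Gamma_add_one hc.ne']
      congr 1
      push_cast
      ring
    rw [e2, e3, mul_one]
    congr 1
    apply Finset.prod_congr rfl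
    intro j _
    congr 1
    push_cast
    ring
  rw [hnum, hA, hC, Nat.factorial_succ]
  have h1 := hP a ha n
  have h2 := hP c hc n
  have h3 := hP (0 + 1) (by norm_num) (n + 1)
  have h4 := hP (2 * c + 1) (by positivity) n
  have h5 := G (a + n * c) (by positivity)
  have h6 := G (c + n * c) (by positivity)
  have h7 := G c hc
  have h8 : (n.factorial : ℝ) ≠ 0 := by exact_mod_cast n.factorial_ne_zero
  have h9 : (n : ℝ) + 1 ≠ 0 := by positivity
  push_cast
  generalize (∏ j ∈ Finset.range (n + 1), Real.Gamma (0 + 1 + j * c)) = B0 at *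
  generalize (∏ j ∈ Finset.range n, Real.Gamma (2 * c + 1 + j * c)) = B1 at *
  have hB' : B0 * (Real.Gamma (c + n * c) * (n + 1)) = B1 * Real.Gamma c := by
    apply mul_left_cancel₀ hc.ne'
    linear_combination hB
  generalize (∏ j ∈ Finset.range n, Real.Gamma (a + 2 * c + ((n : ℝ) - 1 + (j : ℝ)) * c)) = N at *
  generalize (∏ j ∈ Finset.range n, Real.Gamma (a + j * c)) = A at *
  generalize (∏ j ∈ Finset.range n, Real.Gamma (c + j * c)) = C at *
  generalize Real.Gamma (a + n * c) = g1 at *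
  generalize Real.Gamma (c + n * c) = g2 at *
  generalize Real.Gamma c = g at *
  have hden : ((n + 1 : ℝ) * n.factorial) * (A * g1 * (C * g2) * B0) ≠ 0 := by positivity
  have hden2 : (n.factorial : ℝ) * (A * C * B1) ≠ 0 := by positivity
  rw [div_mul_div_comm, div_mul_div_comm, div_eq_div_iff hden hden2]
  linear_combination (-(N * g1 * g ^ n * n.factorial * A * C)) * hB'

theorem morris_step (n : ℕ) (a b c : ℝ) (ha : 0 < a) (hb : 0 ≤ b) (hc : 0 < c) :
    (∏ j ∈ Finset.range n, (b + 1 + j * c)) * morrisSelberg n a (b + 1) c =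
      (∏ j ∈ Finset.range n, (a + b + ((n : ℝ) - 1 + j) * c)) * morrisSelberg n a b c := by
  rw [morrisSelberg, morrisSelberg, mul_left_comm, ← Finset.prod_mul_distrib, mul_left_comm,
    ← Finset.prod_mul_distrib]
  congr 1
  apply Finset.prod_congr rfl
  intro j hj
  have hn : (1 : ℝ) ≤ n := by
    have := Finset.mem_range.1 hj
    exact_mod_cast (by omega : 1 ≤ n)
  have hz : 0 < a + b + ((n : ℝ) - 1 + j) * c := by
    have : 0 ≤ ((n : ℝ) - 1 + j) * c :=
      mul_nonneg (by have : (0 : ℝ) ≤ j := by positivity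
                     linarith) hc.le
    linarith
  have hw : 0 < b + j * c + 1 := by positivity
  have e1 : Real.Gamma (a + (b + 1) + ((n : ℝ) - 1 + j) * c) =
      (a + b + ((n : ℝ) - 1 + j) * c) * Real.Gamma (a + b + ((n : ℝ) - 1 + j) * c) := by
    rw [← Real.Gamma_add_one hz.ne']
    congr 1
    ring
  have e2 : Real.Gamma (b + 1 + j * c + 1) = (b + j * c + 1) * Real.Gamma (b + j * c + 1) := by
    rw [← Real.Gamma_add_one hw.ne']
    congr 1
    ring
  rw [e1, e2, add_right_comm b 1 (j * c)]
  have h1 : Real.Gamma (b + j * c + 1) ≠ 0 := (Real.Gamma_pos_of_pos hw).ne'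
  have h2 : Real.Gamma (a + j * c) ≠ 0 := (Real.Gamma_pos_of_pos (by positivity)).ne'
  have h3 : Real.Gamma (c + j * c) ≠ 0 := (Real.Gamma_pos_of_pos (by positivity)).ne'
  have h4 := hw.ne'
  generalize Real.Gamma (b + j * c + 1) = g1 at *
  generalize b + j * c + 1 = w at *
  field_simp

theorem CT_step (n a b m : ℕ) :
    (∏ j ∈ Finset.range n, ((a : ℝ) + b + ((n : ℝ) - 1 + j) * ((m : ℝ) / 2))) *
      (IterLS.CT n (wt (IterLS.var n) a b m) : ℚ) =
    (∏ j ∈ Finset.range n, ((b : ℝ) + 1 + j * ((m : ℝ) / 2))) *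
      (IterLS.CT n (wt (IterLS.var n) a (b + 1) m) : ℚ) := by
  have h := aomoto_rec (CTHom n) (IterLS.var n) (var_inj n) (var_ne_zero n) (var_ne_one n)
    (exists_euler n) a b m
  rw [CTHom_apply, CTHom_apply] at h
  have h' := congrArg (fun q : ℚ => (q : ℝ)) h
  push_cast at h'
  have e1 : ∏ s ∈ Finset.range n, (2 * ((a : ℝ) + b) + m * (2 * n - 2 - s)) =
      2 ^ n * ∏ j ∈ Finset.range n, ((a : ℝ) + b + ((n : ℝ) - 1 + j) * ((m : ℝ) / 2)) := by
    rw [← Finset.prod_range_reflect, ← Finset.card_range n, ← Finset.prod_const,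
      Finset.card_range, ← Finset.prod_mul_distrib]
    apply Finset.prod_congr rfl
    intro j hj
    have := Finset.mem_range.1 hj
    have hc : ((n - 1 - j : ℕ) : ℝ) = n - 1 - j := by
      rw [Nat.cast_sub (by omega), Nat.cast_sub (by omega)]; simp
    rw [hc]
    ring
  have e2 : ∏ s ∈ Finset.range n, (2 * ((b : ℝ) + 1) + m * (n - 1 - s)) =
      2 ^ n * ∏ j ∈ Finset.range n, ((b : ℝ) + 1 + j * ((m : ℝ) / 2)) := by
    rw [← Finset.prod_range_reflect, ← Finset.card_range n, ← Finset.prod_const,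
      Finset.card_range, ← Finset.prod_mul_distrib]
    apply Finset.prod_congr rfl
    intro j hj
    have := Finset.mem_range.1 hj
    have hc : ((n - 1 - j : ℕ) : ℝ) = n - 1 - j := by
      rw [Nat.cast_sub (by omega), Nat.cast_sub (by omega)]; simp
    rw [hc]
    ring
  rw [e1, e2] at h'
  apply mul_left_cancel₀ (pow_ne_zero n (two_ne_zero : (2 : ℝ) ≠ 0))
  linear_combination h'

theorem main_aux (a m : ℕ) (ha : 0 < a) (hm : 0 < m) : ∀ n b : ℕ,
    ((IterLS.CT n (wt (IterLS.var n) a b m) : ℚ) : ℝ) =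
      morrisSelberg n (a : ℝ) (b : ℝ) ((m : ℝ) / 2) := by
  have ha' : (0 : ℝ) < a := by exact_mod_cast ha
  have hm' : (0 : ℝ) < (m : ℝ) / 2 := by positivity
  intro n
  induction n with
  | zero =>
    intro b
    have : wt (IterLS.var 0) a b m = 1 := by simp [wt]
    rw [this, CT_one]
    simp [morrisSelberg]
  | succ n ih =>
    intro b
    induction b with
    | zero =>
      rw [CT_base, ih m, Nat.cast_zero, morris_base n _ _ ha' hm', mul_div_cancel₀ _ two_ne_zero]
    | succ b ihb =>
      have h1 := CT_step (n + 1) a b m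
      have h2 := morris_step (n + 1) a b ((m : ℝ) / 2) ha' (Nat.cast_nonneg b) hm'
      have hne : (∏ j ∈ Finset.range (n + 1), ((b : ℝ) + 1 + j * ((m : ℝ) / 2))) ≠ 0 :=
        Finset.prod_ne_zero_iff.2 fun j _ => by positivity
      apply mul_left_cancel₀ hne
      rw [← h1, ihb, Nat.cast_add_one b, h2]

/-- **The Morris–Selberg constant term identity**: for positive integers `a`, `m` and a
nonnegative integer `b`, with `c := m/2`,
`CT_{x_n} ⋯ CT_{x_1} ∏ (1-x_i)^{-a} ∏ x_i^{-b} ∏_{i<j} (x_j-x_i)^{-m} = S_n(a,b,c)`. -/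
theorem morris_selberg_constant_term (n : ℕ) (hn : 0 < n) (a : ℕ) (ha : 0 < a)
    (b : ℕ) (m : ℕ) (hm : 0 < m) :
    ((IterLS.CT n
      ((∏ i : Fin n, (1 - IterLS.var n i) ^ (-(a : ℤ))) *
        (∏ i : Fin n, (IterLS.var n i) ^ (-(b : ℤ))) *
        ∏ i : Fin n, ∏ j ∈ Finset.Ioi i,
          (IterLS.var n j - IterLS.var n i) ^ (-(m : ℤ))) : ℚ) : ℝ) =
    morrisSelberg n (a : ℝ) (b : ℝ) ((m : ℝ) / 2) := by
  exact main_aux a m ha hm n b
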